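/- Assume the action of the cyclic group ⟨ω⟩ on Δ₀ is not transitive. Then Φ_re^ω is nonempty and cannot be partitioned into two nonempty subsets Φ₁, Φ₂ with (u, v) = 0 for all u ∈ Φ₁ and v ∈ Φ₂; that is, Φ_re^ω is an irreducible root system in E^ω. -/

import Mathlib

open scoped RealInnerProductSpace

namespace Folding

variable {E : Type*} [NormedAddCommGroup E] [InnerProductSpace ℝ E]

/-- The coroot `α^∨ = 2α/(α,α)` of a nonzero vector `α`. -/
noncomputable def coroot (α : E) : E := (2 / ⟪α, α⟫) • α

/-- The reflection `s_α(x) = x - (α^∨, x) α`. -/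
noncomputable def reflVec (α x : E) : E := x - ⟪coroot α, x⟫ • α

/-- `Φ` is a (finite, not necessarily reduced) root system in `E`. -/
def IsRootSystem (Φ : Set E) : Prop :=
  Φ.Finite ∧ (0 : E) ∉ Φ ∧ Submodule.span ℝ Φ = ⊤ ∧
    (∀ α ∈ Φ, ∀ β ∈ Φ, reflVec α β ∈ Φ) ∧
    ∀ α ∈ Φ, ∀ β ∈ Φ, ∃ n : ℤ, ⟪coroot α, β⟫ = (n : ℝ)

/-- `Φ` is reduced: no root is half of another root. -/
def IsReducedRS (Φ : Set E) : Prop := ∀ α ∈ Φ, (2⁻¹ : ℝ) • α ∉ Φ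

/-- `Φ` is irreducible: nonempty and not a disjoint union of two nonempty
mutually orthogonal subsets. -/
def IsIrreducibleRS (Φ : Set E) : Prop :=
  Φ.Nonempty ∧
    ¬∃ Φ₁ Φ₂ : Set E, Φ₁.Nonempty ∧ Φ₂.Nonempty ∧ Φ₁ ∪ Φ₂ = Φ ∧ Disjoint Φ₁ Φ₂ ∧
      ∀ u ∈ Φ₁, ∀ v ∈ Φ₂, ⟪u, v⟫ = 0

/-- `Δ` is a basis (a set of simple roots) of the root system `Φ`:
it is a vector space basis of `E`, and every root is a linear combination of `Δ`
whose coefficients are all nonnegative integers or all nonpositive integers. -/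
def IsBaseRS (Φ : Set E) (Δ : Finset E) : Prop :=
  ↑Δ ⊆ Φ ∧ LinearIndependent ℝ (fun α : {x : E // x ∈ Δ} => (α : E)) ∧
    Submodule.span ℝ (Δ : Set E) = ⊤ ∧
    ∀ β ∈ Φ, ∃ c : E → ℤ, ((∀ α, 0 ≤ c α) ∨ (∀ α, c α ≤ 0)) ∧
      β = ∑ α ∈ Δ, (c α : ℝ) • α

/-- `ω` belongs to the Weyl group of `Φ`: it is a product of reflections in roots. -/
def InWeylGroup (Φ : Set E) (ω : E ≃ₗᵢ[ℝ] E) : Prop :=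
  ∃ l : List E, (∀ α ∈ l, α ∈ Φ) ∧ ∀ x : E, ω x = l.foldr reflVec x

/-- The average `x^ω = (1/o(ω)) Σ_{t=1}^{o(ω)} ω^t(x)`, where `o(ω)` is the order of `ω`. -/
noncomputable def avg (ω : E ≃ₗᵢ[ℝ] E) (x : E) : E :=
  (orderOf ω : ℝ)⁻¹ • ∑ t ∈ Finset.range (orderOf ω), (ω ^ (t + 1)) x

/-- The fixed-point set `E^ω`. -/
def fixedSet (ω : E ≃ₗᵢ[ℝ] E) : Set E := {x | ω x = x}

/-- The fixed-point subspace `E^ω`. -/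
def fixedSubmodule (ω : E ≃ₗᵢ[ℝ] E) : Submodule ℝ E :=
  LinearMap.ker ((ω.toLinearEquiv : E →ₗ[ℝ] E) - LinearMap.id)

/-- The folded root system `Φ_re^ω = {β^ω : β ∈ Φ, β^ω ≠ 0}`. -/
noncomputable def foldedRoots (Φ : Set E) (ω : E ≃ₗᵢ[ℝ] E) : Set E :=
  {v | v ≠ 0 ∧ ∃ β ∈ Φ, avg ω β = v}

/-- The `⟨ω⟩`-orbit `O(β) = {ω^t(β) : t ∈ ℤ}`. -/
def orbitOf (ω : E ≃ₗᵢ[ℝ] E) (β : E) : Set E := {γ | ∃ t : ℤ, (ω ^ t) β = γ}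

/-- `N(β) = {γ ∈ O(β) : γ ≠ ±β, (β,γ) ≠ 0}`. -/
def nbrOf (ω : E ≃ₗᵢ[ℝ] E) (β : E) : Set E :=
  {γ | γ ∈ orbitOf ω β ∧ γ ≠ β ∧ γ ≠ -β ∧ ⟪β, γ⟫ ≠ 0}


/-- `Δ^ω`: the averages of the simple roots whose `⟨ω⟩`-orbit avoids `α₀ = -htilde`. -/
noncomputable def simpleAvg (Δ : Finset E) (htilde : E) (ω : E ≃ₗᵢ[ℝ] E) : Set E :=
  {v | ∃ α ∈ (Δ : Set E), -htilde ∉ orbitOf ω α ∧ avg ω α = v}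

/-- `π̄_S = (Σ_{α ∈ S} ϖ_α^∨)^ω` for a subset `S` of `Δ₀`. -/
noncomputable def pibar (ω : E ≃ₗᵢ[ℝ] E) (ϖ : E → E) (S : Set E) : E :=
  avg ω (∑ᶠ γ ∈ S, ϖ γ)

end Folding


open Folding

namespace Folding

variable {E : Type*} [NormedAddCommGroup E] [InnerProductSpace ℝ E]

theorem IsBaseRS.eq_zero {Φ : Set E} {Δ : Finset E} (hΔ : IsBaseRS Φ Δ) {f : E → ℝ}
    (hf : ∑ α ∈ Δ, f α • α = 0) : ∀ α ∈ Δ, f α = 0 := by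
  intro α hα
  have h := Fintype.linearIndependent_iff.1 hΔ.2.1 (fun x => f x)
    (by rw [← hf]; exact Finset.sum_coe_sort Δ (fun x => f x • x))
  exact h ⟨α, hα⟩

theorem IsBaseRS.coeff_eq {Φ : Set E} {Δ : Finset E} (hΔ : IsBaseRS Φ Δ) {f g : E → ℝ}
    (h : ∑ α ∈ Δ, f α • α = ∑ α ∈ Δ, g α • α) : ∀ α ∈ Δ, f α = g α := by
  intro α hα
  have := hΔ.eq_zero (f := fun x => f x - g x)
    (by simp only [sub_smul, Finset.sum_sub_distrib, h, sub_self]) α hα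
  linarith

theorem IsBaseRS.sameSign {Φ : Set E} {Δ : Finset E} (hΔ : IsBaseRS Φ Δ) {β : E} (hβ : β ∈ Φ)
    {f : E → ℝ} (hf : β = ∑ α ∈ Δ, f α • α) :
    (∀ α ∈ Δ, 0 ≤ f α) ∨ (∀ α ∈ Δ, f α ≤ 0) := by
  obtain ⟨c, hc, hβc⟩ := hΔ.2.2.2 β hβ
  have h := hΔ.coeff_eq (hf.symm.trans hβc)
  refine hc.imp ?_ ?_ <;> intro hc α hα <;> rw [h α hα] <;> exact_mod_cast hc α

theorem inner_coroot (α x : E) : ⟪coroot α, x⟫ = 2 / ⟪α, α⟫ * ⟪α, x⟫ := by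
  rw [coroot, real_inner_smul_left]

theorem IsRootSystem.inner_self_pos {Φ : Set E} (hΦ : IsRootSystem Φ) {α : E} (hα : α ∈ Φ) :
    0 < ⟪α, α⟫ :=
  real_inner_self_pos.2 (fun h => hΦ.2.1 (h ▸ hα))

theorem IsRootSystem.neg_mem {Φ : Set E} (hΦ : IsRootSystem Φ) {α : E} (hα : α ∈ Φ) :
    -α ∈ Φ := by
  have h := hΦ.2.2.2.1 α hα α hα
  rw [reflVec, inner_coroot, div_mul_cancel₀ _ (hΦ.inner_self_pos hα).ne', two_smul] at h
  simpa using h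

/-- Coefficients of `s_α(β)` for a simple root `α`. -/
theorem reflVec_eq_sum [DecidableEq E] {Δ : Finset E} {α β : E} (hα : α ∈ Δ) {f : E → ℝ}
    (hf : β = ∑ x ∈ Δ, f x • x) :
    reflVec α β = ∑ x ∈ Δ, (f x - if x = α then ⟪coroot α, β⟫ else 0) • x := by
  simp only [sub_smul, Finset.sum_sub_distrib, ite_smul, zero_smul, Finset.sum_ite_eq', hα,
    if_true, ← hf, reflVec]

theorem IsBaseRS.inner_nonpos {Φ : Set E} {Δ : Finset E} (hΦ : IsRootSystem Φ)
    (hΔ : IsBaseRS Φ Δ) {α β : E} (hα : α ∈ Δ) (hβ : β ∈ Δ) (hne : α ≠ β) : ⟪α, β⟫ ≤ 0 := by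
  classical
  have hf : β = ∑ x ∈ Δ, (if x = β then (1 : ℝ) else 0) • x := by
    simp [ite_smul, hβ]
  have hs := hΔ.sameSign (hΦ.2.2.2.1 α (hΔ.1 hα) β (hΔ.1 hβ)) (reflVec_eq_sum hα hf)
  have hpos := hΦ.inner_self_pos (hΔ.1 hα)
  rcases hs with h | h
  · have := h α hα
    simp only [hne, if_false, if_true, zero_sub, inner_coroot] at this
    by_contra hc
    have : 0 < 2 / ⟪α, α⟫ * ⟪α, β⟫ := mul_pos (by positivity) (not_le.1 hc)
    linarith
  · have := h β hβ
    simp only [hne.symm, if_false, if_true] at this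
    linarith

section Coefficients

variable {Φ : Set E} {Δ : Finset E} {coeff : E → E → ℝ}

/-- If the simple roots split into two orthogonal parts, no positive root is supported on both. -/
theorem not_mixed_of_orthogonal (hΦ : IsRootSystem Φ) (hΔ : IsBaseRS Φ Δ)
    (hcoeff : ∀ β ∈ Φ, β = ∑ α ∈ Δ, coeff β α • α) (p : E → Prop)
    (hp : ∀ α ∈ Δ, p α → ∀ β ∈ Δ, ¬ p β → ⟪α, β⟫ = 0) (γ : E) (hγ : γ ∈ Φ) :
    ¬ ((∃ α ∈ Δ, p α ∧ 0 < coeff γ α) ∧ ∃ α ∈ Δ, ¬ p α ∧ 0 < coeff γ α) := by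
  classical
  intro hmix
  let M : Set E := {γ ∈ Φ | (∃ α ∈ Δ, p α ∧ 0 < coeff γ α) ∧ ∃ α ∈ Δ, ¬ p α ∧ 0 < coeff γ α}
  obtain ⟨β, ⟨hβ, ⟨a, ha, hpa, hca⟩, b, hb, hpb, hcb⟩, hmin⟩ :=
    Set.exists_min_image M (fun γ => ∑ α ∈ Δ, coeff γ α)
      (hΦ.1.subset (Set.sep_subset _ _)) ⟨γ, hγ, hmix⟩
  have hnonneg : ∀ α ∈ Δ, 0 ≤ coeff β α :=
    (hΔ.sameSign hβ (hcoeff β hβ)).resolve_right (fun h => absurd (h a ha) (not_le.2 hca))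
  let s : E := ∑ x ∈ Δ, (if p x then coeff β x else 0) • x
  have hs0 : s ≠ 0 := by
    intro h
    have := hΔ.eq_zero h a ha
    simp only [hpa, if_true] at this
    linarith
  have hinner : ∀ α ∈ Δ, p α → ⟪α, β⟫ = ⟪α, s⟫ := by
    intro α hα hpα
    conv_lhs => rw [hcoeff β hβ]
    rw [inner_sum, inner_sum]
    refine Finset.sum_congr rfl fun x hx => ?_
    by_cases hpx : p x
    · simp [hpx]
    · simp [hpx, real_inner_smul_right, hp α hα hpα x hx hpx]
  obtain ⟨α, hα, hpos⟩ : ∃ α ∈ Δ, 0 < (if p α then coeff β α else 0) * ⟪α, s⟫ := by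
    by_contra! hcon
    have h1 : 0 < ⟪s, s⟫ := real_inner_self_pos.2 hs0
    have h2 : ⟪s, s⟫ = ∑ x ∈ Δ, (if p x then coeff β x else 0) * ⟪x, s⟫ := by
      conv_lhs => enter [2]; change ∑ x ∈ Δ, (if p x then coeff β x else 0) • x
      rw [sum_inner]
      exact Finset.sum_congr rfl fun x _ => real_inner_smul_left _ _ _
    exact absurd (h2 ▸ Finset.sum_nonpos hcon) (not_le.2 h1)
  have hpα : p α := by
    by_contra h
    simp [h] at hpos
  rw [if_pos hpα] at hpos
  have hαs : 0 < ⟪α, s⟫ := pos_of_mul_pos_right hpos (hnonneg α hα)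
  have hαα := hΦ.inner_self_pos (hΔ.1 hα)
  have hk : 0 < ⟪coroot α, β⟫ := by
    rw [inner_coroot, hinner α hα hpα]
    positivity
  have hrefl := hΦ.2.2.2.1 α (hΔ.1 hα) β hβ
  have hsum := reflVec_eq_sum hα (hcoeff β hβ)
  have heq := hΔ.coeff_eq ((hcoeff _ hrefl).symm.trans hsum)
  have hbα : b ≠ α := fun h => hpb (h ▸ hpα)
  have hb' : 0 < coeff (reflVec α β) b := by simpa [heq b hb, hbα] using hcb
  have hnonneg' : ∀ x ∈ Δ, 0 ≤ coeff (reflVec α β) x :=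
    (hΔ.sameSign hrefl (hcoeff _ hrefl)).resolve_right
      (fun h => absurd (h b hb) (not_le.2 hb'))
  have hmem : reflVec α β ∈ M := by
    refine ⟨hrefl, ?_, b, hb, hpb, hb'⟩
    by_contra! hcon
    have hs : s = ⟪coroot α, β⟫ • α := by
      have : s = ∑ x ∈ Δ, (if x = α then ⟪coroot α, β⟫ else 0) • x := by
        refine Finset.sum_congr rfl fun x hx => ?_
        by_cases hpx : p x
        · have h0 := le_antisymm (hcon x hx hpx) (hnonneg' x hx)
          rw [heq x hx, sub_eq_zero] at h0
          rw [if_pos hpx, h0]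
        · have : x ≠ α := fun h => hpx (h ▸ hpα)
          simp [hpx, this]
      rw [this]
      simp [ite_smul, hα]
    have h1 : ⟪coroot α, β⟫ = 2 * ⟪coroot α, β⟫ := by
      conv_lhs => rw [inner_coroot, hinner α hα hpα, hs, real_inner_smul_right]
      field_simp
    linarith
  have hle := hmin _ hmem
  simp only [Finset.sum_congr rfl heq, Finset.sum_sub_distrib, Finset.sum_ite_eq', hα,
    if_true] at hle
  linarith

theorem supported_of_orthogonal (hΦ : IsRootSystem Φ) (hΔ : IsBaseRS Φ Δ)
    (hcoeff : ∀ β ∈ Φ, β = ∑ α ∈ Δ, coeff β α • α) (p : E → Prop)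
    (hp : ∀ α ∈ Δ, p α → ∀ β ∈ Δ, ¬ p β → ⟪α, β⟫ = 0) (γ : E) (hγ : γ ∈ Φ) :
    (∀ α ∈ Δ, ¬ p α → coeff γ α = 0) ∨ (∀ α ∈ Δ, p α → coeff γ α = 0) := by
  by_contra! hcon
  obtain ⟨⟨b, hb, hpb, hcb⟩, a, ha, hpa, hca⟩ := hcon
  rcases hΔ.sameSign hγ (hcoeff γ hγ) with h | h
  · exact not_mixed_of_orthogonal hΦ hΔ hcoeff p hp γ hγ
      ⟨⟨a, ha, hpa, (h a ha).lt_of_ne' hca⟩, b, hb, hpb, (h b hb).lt_of_ne' hcb⟩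
  · have hneg := hΦ.neg_mem hγ
    have heq : ∀ α ∈ Δ, coeff (-γ) α = -coeff γ α := by
      apply hΔ.coeff_eq
      simp only [neg_smul, Finset.sum_neg_distrib]
      rw [← hcoeff _ hneg, ← hcoeff _ hγ]
    refine not_mixed_of_orthogonal hΦ hΔ hcoeff p hp (-γ) hneg
      ⟨⟨a, ha, hpa, ?_⟩, b, hb, hpb, ?_⟩
    · rw [heq a ha]; exact neg_pos.2 ((h a ha).lt_of_ne hca)
    · rw [heq b hb]; exact neg_pos.2 ((h b hb).lt_of_ne hcb)

/-- The simple roots of an irreducible root system cannot be split into two nonempty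
orthogonal parts. -/
theorem IsIrreducibleRS.base_connected (hΦ : IsRootSystem Φ) (hirr : IsIrreducibleRS Φ)
    (hΔ : IsBaseRS Φ Δ) (hcoeff : ∀ β ∈ Φ, β = ∑ α ∈ Δ, coeff β α • α) (p : E → Prop)
    (hp : ∀ α ∈ Δ, p α → ∀ β ∈ Δ, ¬ p β → ⟪α, β⟫ = 0)
    (hex : ∃ α ∈ Δ, p α) : ∀ α ∈ Δ, p α := by
  classical
  by_contra! hcon
  obtain ⟨a, ha, hpa⟩ := hex
  obtain ⟨b, hb, hpb⟩ := hcon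
  have hsimple : ∀ α ∈ Δ, ∀ x ∈ Δ, x ≠ α → coeff α x = 0 := by
    intro α hα x hx hne
    have := hΔ.coeff_eq (f := coeff α) (g := fun x => if x = α then 1 else 0)
      (by rw [← hcoeff α (hΔ.1 hα)]; simp [ite_smul, hα]) x hx
    simpa [hne] using this
  refine hirr.2 ⟨{γ ∈ Φ | ∀ α ∈ Δ, ¬ p α → coeff γ α = 0},
    {γ ∈ Φ | ∀ α ∈ Δ, p α → coeff γ α = 0},
    ⟨a, hΔ.1 ha, fun x hx hpx => hsimple a ha x hx (fun h => hpx (h ▸ hpa))⟩,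
    ⟨b, hΔ.1 hb, fun x hx hpx => hsimple b hb x hx (fun h => hpb (h ▸ hpx))⟩, ?_, ?_, ?_⟩
  · ext γ
    constructor
    · rintro (h | h) <;> exact h.1
    · intro hγ
      exact (supported_of_orthogonal hΦ hΔ hcoeff p hp γ hγ).imp (⟨hγ, ·⟩) (⟨hγ, ·⟩)
  · rw [Set.disjoint_left]
    rintro γ ⟨hγ, h1⟩ ⟨-, h2⟩
    apply hΦ.2.1
    have : γ = 0 := by
      rw [hcoeff γ hγ]
      refine Finset.sum_eq_zero fun x hx => ?_
      by_cases hpx : p x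
      · rw [h2 x hx hpx, zero_smul]
      · rw [h1 x hx hpx, zero_smul]
    exact this ▸ hγ
  · rintro u ⟨hu, h1⟩ v ⟨hv, h2⟩
    rw [hcoeff u hu, hcoeff v hv, sum_inner]
    refine Finset.sum_eq_zero fun x hx => ?_
    rw [inner_sum]
    refine Finset.sum_eq_zero fun y hy => ?_
    rw [real_inner_smul_left, real_inner_smul_right]
    by_cases hpx : p x
    · by_cases hpy : p y
      · simp [h2 y hy hpy]
      · simp [hp x hx hpx y hy hpy]
    · simp [h1 x hx hpx]

variable {htilde : E}

/-- The highest root is dominant. -/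
theorem inner_highest_nonneg (hΦ : IsRootSystem Φ) (hΔ : IsBaseRS Φ Δ)
    (hcoeff : ∀ β ∈ Φ, β = ∑ α ∈ Δ, coeff β α • α) (hht : htilde ∈ Φ)
    (hhighest : ∀ β ∈ Φ, β ≠ htilde → ∑ α ∈ Δ, coeff β α < ∑ α ∈ Δ, coeff htilde α)
    {α : E} (hα : α ∈ Δ) : 0 ≤ ⟪α, htilde⟫ := by
  classical
  by_contra! hneg
  have hk : ⟪coroot α, htilde⟫ < 0 := by
    rw [inner_coroot]
    have := hΦ.inner_self_pos (hΔ.1 hα)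
    exact mul_neg_of_pos_of_neg (by positivity) hneg
  have hrefl := hΦ.2.2.2.1 α (hΔ.1 hα) htilde hht
  have heq := hΔ.coeff_eq
    ((hcoeff _ hrefl).symm.trans (reflVec_eq_sum hα (hcoeff htilde hht)))
  have hle : ∑ x ∈ Δ, coeff (reflVec α htilde) x ≤ ∑ x ∈ Δ, coeff htilde x := by
    by_cases h : reflVec α htilde = htilde
    · rw [h]
    · exact (hhighest _ hrefl h).le
  simp only [Finset.sum_congr rfl heq, Finset.sum_sub_distrib, Finset.sum_ite_eq', hα,
    if_true] at hle
  linarith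

theorem sum_coeff_simple (hΔ : IsBaseRS Φ Δ)
    (hcoeff : ∀ β ∈ Φ, β = ∑ α ∈ Δ, coeff β α • α) {α : E} (hα : α ∈ Δ) :
    ∑ x ∈ Δ, coeff α x = 1 := by
  classical
  have := hΔ.coeff_eq (f := coeff α) (g := fun x => if x = α then 1 else 0)
    (by rw [← hcoeff α (hΔ.1 hα)]; simp [ite_smul, hα])
  rw [Finset.sum_congr rfl this]
  simp [hα]

theorem IsBaseRS.nonempty (hΔ : IsBaseRS Φ Δ) (hΦ : IsRootSystem Φ) (hne : Φ.Nonempty) :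
    Δ.Nonempty := by
  by_contra h
  rw [Finset.not_nonempty_iff_eq_empty] at h
  obtain ⟨β, hβ⟩ := hne
  obtain ⟨c, -, hc⟩ := hΔ.2.2.2 β hβ
  rw [h, Finset.sum_empty] at hc
  exact hΦ.2.1 (hc ▸ hβ)

theorem one_le_sum_coeff_highest (hΔ : IsBaseRS Φ Δ) (hΦ : IsRootSystem Φ)
    (hcoeff : ∀ β ∈ Φ, β = ∑ α ∈ Δ, coeff β α • α) (hht : htilde ∈ Φ)
    (hhighest : ∀ β ∈ Φ, β ≠ htilde → ∑ α ∈ Δ, coeff β α < ∑ α ∈ Δ, coeff htilde α) :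
    1 ≤ ∑ α ∈ Δ, coeff htilde α := by
  obtain ⟨a, ha⟩ := hΔ.nonempty hΦ ⟨_, hht⟩
  have h1 := sum_coeff_simple hΔ hcoeff ha
  by_cases h : a = htilde
  · rw [← h, h1]
  · exact h1 ▸ (hhighest a (hΔ.1 ha) h).le

theorem neg_highest_notMem (hΔ : IsBaseRS Φ Δ) (hΦ : IsRootSystem Φ)
    (hcoeff : ∀ β ∈ Φ, β = ∑ α ∈ Δ, coeff β α • α) (hht : htilde ∈ Φ)
    (hhighest : ∀ β ∈ Φ, β ≠ htilde → ∑ α ∈ Δ, coeff β α < ∑ α ∈ Δ, coeff htilde α) :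
    -htilde ∉ Δ := by
  intro hmem
  have h1 := one_le_sum_coeff_highest hΔ hΦ hcoeff hht hhighest
  have h2 := sum_coeff_simple hΔ hcoeff hmem
  have heq : ∀ α ∈ Δ, coeff (-htilde) α = -coeff htilde α := by
    apply hΔ.coeff_eq
    simp only [neg_smul, Finset.sum_neg_distrib]
    rw [← hcoeff _ (hΔ.1 hmem), ← hcoeff _ hht]
  rw [Finset.sum_congr rfl heq, Finset.sum_neg_distrib] at h2
  linarith

/-- All coefficients of the highest root of an irreducible root system are positive. -/
theorem coeff_highest_pos (hΦ : IsRootSystem Φ) (hirr : IsIrreducibleRS Φ) (hΔ : IsBaseRS Φ Δ)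
    (hcoeff : ∀ β ∈ Φ, β = ∑ α ∈ Δ, coeff β α • α) (hht : htilde ∈ Φ)
    (hhighest : ∀ β ∈ Φ, β ≠ htilde → ∑ α ∈ Δ, coeff β α < ∑ α ∈ Δ, coeff htilde α) :
    ∀ α ∈ Δ, 0 < coeff htilde α := by
  have h1 := one_le_sum_coeff_highest hΔ hΦ hcoeff hht hhighest
  have hnonneg : ∀ α ∈ Δ, 0 ≤ coeff htilde α :=
    (hΔ.sameSign hht (hcoeff _ hht)).resolve_right
      (fun h => by linarith [Finset.sum_nonpos h])
  refine hirr.base_connected hΦ hΔ hcoeff (fun α => 0 < coeff htilde α) ?_ ?_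
  · intro α hα hpα β hβ hpβ
    have hle : ∀ x ∈ Δ, coeff htilde x * ⟪β, x⟫ ≤ 0 := by
      intro x hx
      by_cases hxβ : x = β
      · rw [hxβ, le_antisymm (not_lt.1 hpβ) (hnonneg β hβ), zero_mul]
      · exact mul_nonpos_of_nonneg_of_nonpos (hnonneg x hx)
          (hΔ.inner_nonpos hΦ hβ hx (Ne.symm hxβ))
    have hsum : ⟪β, htilde⟫ = ∑ x ∈ Δ, coeff htilde x * ⟪β, x⟫ := by
      conv_lhs => rw [hcoeff _ hht]
      rw [inner_sum]
      exact Finset.sum_congr rfl fun x _ => real_inner_smul_right _ _ _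
    have hdom := inner_highest_nonneg hΦ hΔ hcoeff hht hhighest hβ
    have h0 := (Finset.sum_eq_zero_iff_of_nonpos hle).1
      (le_antisymm (Finset.sum_nonpos hle) (hsum ▸ hdom)) α hα
    rw [real_inner_comm]
    exact (mul_eq_zero.1 h0).resolve_left hpα.ne'
  · by_contra! hcon
    linarith [Finset.sum_nonpos hcon]

/-- A linear relation among the extended simple roots with one vanishing coefficient is
trivial. -/
theorem extended_relation_eq_zero [DecidableEq E] (hΔ : IsBaseRS Φ Δ)
    (hh : htilde = ∑ α ∈ Δ, coeff htilde α • α)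
    (hpos : ∀ α ∈ Δ, 0 < coeff htilde α) (hmem : -htilde ∉ Δ) {c : E → ℝ}
    (hc : ∑ x ∈ insert (-htilde) Δ, c x • x = 0) {y : E} (hy : y ∈ insert (-htilde) Δ)
    (hcy : c y = 0) : ∀ x ∈ insert (-htilde) Δ, c x = 0 := by
  rw [Finset.sum_insert hmem] at hc
  have heq : ∀ α ∈ Δ, c α = c (-htilde) * coeff htilde α := by
    apply hΔ.coeff_eq
    simp only [mul_smul, ← Finset.smul_sum, ← hh]
    rw [smul_neg, neg_add_eq_zero] at hc
    exact hc.symm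
  have h0 : c (-htilde) = 0 := by
    rcases Finset.mem_insert.1 hy with rfl | hy
    · exact hcy
    · rw [heq y hy] at hcy
      exact (mul_eq_zero.1 hcy).resolve_right (hpos y hy).ne'
  intro x hx
  rcases Finset.mem_insert.1 hx with rfl | hx
  · exact h0
  · rw [heq x hx, h0, zero_mul]

end Coefficients

theorem pow_mem_of_image_eq {ω : E ≃ₗᵢ[ℝ] E} {S : Set E} (h : ω '' S = S) (n : ℕ) {x : E}
    (hx : x ∈ S) : (ω ^ n) x ∈ S := by
  induction n with
  | zero => exact hx
  | succ n ih =>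
    rw [pow_succ', LinearIsometryEquiv.coe_mul, Function.comp_apply, ← h]
    exact Set.mem_image_of_mem _ ih

theorem isOfFinOrder_of_image_eq {ω : E ≃ₗᵢ[ℝ] E} {S : Set E} (hS : S.Finite)
    (hspan : Submodule.span ℝ S = ⊤) (h : ω '' S = S) : IsOfFinOrder ω := by
  by_contra hinf
  have hinj := injective_pow_iff_not_isOfFinOrder.2 hinf
  have := hS.to_subtype
  obtain ⟨m, n, hmn, heq⟩ := Finite.exists_ne_map_eq_of_infinite
    (fun (n : ℕ) (x : S) => (⟨(ω ^ n) x, pow_mem_of_image_eq h n x.2⟩ : S))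
  refine hmn (hinj ?_)
  have hlin : ((ω ^ m).toLinearEquiv : E →ₗ[ℝ] E) = ((ω ^ n).toLinearEquiv : E →ₗ[ℝ] E) :=
    LinearMap.ext_on hspan fun x hx => congrArg Subtype.val (congrFun heq ⟨x, hx⟩)
  exact LinearIsometryEquiv.ext fun x => LinearMap.congr_fun hlin x

theorem avg_sum_smul (ω : E ≃ₗᵢ[ℝ] E) (s : Finset E) (c : E → ℝ) :
    avg ω (∑ x ∈ s, c x • x) = ∑ x ∈ s, c x • avg ω x := by
  simp only [avg, map_sum, map_smul]
  rw [Finset.sum_comm, Finset.smul_sum]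
  refine Finset.sum_congr rfl fun x _ => ?_
  rw [← Finset.smul_sum, smul_comm]

theorem avg_apply_self (ω : E ≃ₗᵢ[ℝ] E) (x : E) : avg ω (ω x) = avg ω x := by
  have h : ∀ t : ℕ, (ω ^ (t + 1)) (ω x) = (ω ^ (t + 1 + 1)) x := fun t => by
    rw [pow_succ ω (t + 1)]; rfl
  have h1 := Finset.sum_range_succ (fun t => (ω ^ (t + 1)) x) (orderOf ω)
  rw [Finset.sum_range_succ', pow_succ ω (orderOf ω), pow_orderOf_eq_one, zero_add, one_mul,
    pow_one] at h1
  simp only [avg, h]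
  rw [add_right_cancel h1]

theorem avg_pow_apply (ω : E ≃ₗᵢ[ℝ] E) (n : ℕ) (x : E) : avg ω ((ω ^ n) x) = avg ω x := by
  induction n with
  | zero => rfl
  | succ n ih =>
    rw [pow_succ', LinearIsometryEquiv.coe_mul, Function.comp_apply, avg_apply_self, ih]

/-- If all translates of `a` and `b` have nonpositive inner products and the averages are
orthogonal, then `a` and `b` are orthogonal. -/
theorem inner_eq_zero_of_inner_avg_eq_zero {ω : E ≃ₗᵢ[ℝ] E} (hω : IsOfFinOrder ω) {a b : E}
    (hle : ∀ s t : ℕ, ⟪(ω ^ s) a, (ω ^ t) b⟫ ≤ 0) (h : ⟪avg ω a, avg ω b⟫ = 0) :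
    ⟪a, b⟫ = 0 := by
  have hpos := hω.orderOf_pos
  have hne : ((orderOf ω : ℝ)⁻¹) ≠ 0 := inv_ne_zero (by exact_mod_cast hpos.ne')
  rw [avg, avg, real_inner_smul_left, real_inner_smul_right, mul_eq_zero, mul_eq_zero] at h
  have h := (h.resolve_left hne).resolve_left hne
  rw [sum_inner] at h
  have hlast : orderOf ω - 1 ∈ Finset.range (orderOf ω) := Finset.mem_range.2 (by omega)
  have h := (Finset.sum_eq_zero_iff_of_nonpos fun s _ => by
    rw [inner_sum]; exact Finset.sum_nonpos fun t _ => hle _ _).1 h _ hlast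
  rw [inner_sum] at h
  have h := (Finset.sum_eq_zero_iff_of_nonpos fun t _ => hle _ _).1 h _ hlast
  rwa [Nat.sub_add_cancel hpos, pow_orderOf_eq_one] at h

end Folding


theorem folded_irreducible
    {E : Type*} [NormedAddCommGroup E] [InnerProductSpace ℝ E] [FiniteDimensional ℝ E]
    (Φ : Set E) (Δ : Finset E) (coeff : E → E → ℝ) (htilde : E) (ω : E ≃ₗᵢ[ℝ] E)
    (hΦrs : IsRootSystem Φ) (hΦred : IsReducedRS Φ) (hΦirr : IsIrreducibleRS Φ)
    (hΔ : IsBaseRS Φ Δ)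
    (hcoeff : ∀ β ∈ Φ, β = ∑ α ∈ Δ, coeff β α • α)
    (hht : htilde ∈ Φ)
    (hhighest : ∀ β ∈ Φ, β ≠ htilde → ∑ α ∈ Δ, coeff β α < ∑ α ∈ Δ, coeff htilde α)
    (hωW : InWeylGroup Φ ω)
    (hωΔ₀ : ⇑ω '' (↑Δ ∪ {-htilde}) = ↑Δ ∪ {-htilde})
    (hnt : ¬ ∀ α ∈ (↑Δ ∪ {-htilde} : Set E), ∀ β ∈ (↑Δ ∪ {-htilde} : Set E),
      β ∈ orbitOf ω α) :
    IsIrreducibleRS (foldedRoots Φ ω) := by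
  classical
  have hpos := coeff_highest_pos hΦrs hΦirr hΔ hcoeff hht hhighest
  have hmem := neg_highest_notMem hΔ hΦrs hcoeff hht hhighest
  have hh := hcoeff htilde hht
  set D : Finset E := insert (-htilde) Δ with hD
  have hDset : (↑Δ ∪ {-htilde} : Set E) = ↑D := by
    rw [hD, Finset.coe_insert, Set.union_singleton]
  rw [hDset] at hωΔ₀ hnt
  have hDΦ : ∀ x ∈ D, x ∈ Φ := by
    intro x hx
    rcases Finset.mem_insert.1 hx with rfl | hx
    · exact hΦrs.neg_mem hht
    · exact hΔ.1 hx
  have hfin : IsOfFinOrder ω := by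
    refine isOfFinOrder_of_image_eq D.finite_toSet (top_le_iff.1 ?_) hωΔ₀
    rw [← hΔ.2.2.1]
    exact Submodule.span_mono (by simp [hD])
  have hpow : ∀ (n : ℕ) {x : E}, x ∈ D → (ω ^ n) x ∈ D := fun n x hx =>
    pow_mem_of_image_eq hωΔ₀ n hx
  have hinner : ∀ x ∈ D, ∀ y ∈ D, x ≠ y → ⟪x, y⟫ ≤ 0 := by
    have hdom : ∀ α ∈ Δ, ⟪α, -htilde⟫ ≤ 0 := fun α hα => by
      rw [inner_neg_right, neg_nonpos]
      exact inner_highest_nonneg hΦrs hΔ hcoeff hht hhighest hα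
    intro x hx y hy hne
    rcases Finset.mem_insert.1 hx with rfl | hx <;> rcases Finset.mem_insert.1 hy with rfl | hy
    · exact absurd rfl hne
    · rw [real_inner_comm]; exact hdom y hy
    · exact hdom x hx
    · exact hΔ.inner_nonpos hΦrs hx hy hne
  have hself : ∀ v ∈ foldedRoots Φ ω, ∃ x ∈ D, ⟪v, avg ω x⟫ ≠ 0 := by
    rintro v ⟨hv, β, hβ, rfl⟩
    by_contra! hcon
    refine hv (inner_self_eq_zero (𝕜 := ℝ).1 ?_)
    conv_lhs => enter [3]; rw [hcoeff β hβ, avg_sum_smul]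
    rw [inner_sum]
    refine Finset.sum_eq_zero fun x hx => ?_
    rw [real_inner_smul_right, hcon x (Finset.mem_insert_of_mem hx), mul_zero]
  constructor
  · push Not at hnt
    obtain ⟨a, ha, b, hb, hab⟩ := hnt
    refine ⟨avg ω a, ?_, a, hDΦ a ha, rfl⟩
    intro h0
    rw [avg, smul_eq_zero] at h0
    have h0 := h0.resolve_left (inv_ne_zero (by exact_mod_cast hfin.orderOf_pos.ne'))
    let c : E → ℝ := fun x =>
      (((Finset.range (orderOf ω)).filter fun t => (ω ^ (t + 1)) a = x).card : ℝ)
    have hc : ∑ x ∈ D, c x • x = 0 := by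
      rw [← h0, ← Finset.sum_fiberwise_of_maps_to (t := D)
        (g := fun t => (ω ^ (t + 1)) a) (fun t _ => hpow (t + 1) ha)]
      refine Finset.sum_congr rfl fun x _ => ?_
      rw [Finset.sum_congr rfl (g := fun _ => x) fun t ht => (Finset.mem_filter.1 ht).2,
        Finset.sum_const, Nat.cast_smul_eq_nsmul]
    have hcb : c b = 0 := by
      simp only [c, Nat.cast_eq_zero, Finset.card_eq_zero, Finset.filter_eq_empty_iff]
      intro t _ ht
      exact hab ⟨(t + 1 : ℕ), by rw [zpow_natCast]; exact ht⟩
    have hca := extended_relation_eq_zero hΔ hh hpos hmem hc hb hcb a ha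
    simp only [c, Nat.cast_eq_zero, Finset.card_eq_zero, Finset.filter_eq_empty_iff] at hca
    have hop := hfin.orderOf_pos
    refine hca (x := orderOf ω - 1) (Finset.mem_range.2 (by omega)) ?_
    rw [Nat.sub_add_cancel hop, pow_orderOf_eq_one]
    rfl
  · rintro ⟨Φ₁, Φ₂, ⟨u, hu⟩, ⟨v, hv⟩, hunion, -, horth⟩
    have havg : ∀ x ∈ D, avg ω x ∉ Φ₁ → avg ω x = 0 ∨ avg ω x ∈ Φ₂ := by
      intro x hx hx1
      by_cases h0 : avg ω x = 0
      · exact Or.inl h0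
      · have : avg ω x ∈ Φ₁ ∪ Φ₂ := hunion ▸ ⟨h0, x, hDΦ x hx, rfl⟩
        exact Or.inr (this.resolve_left hx1)
    obtain ⟨a, ha, hua⟩ := hself u (hunion ▸ Or.inl hu)
    have ha1 : avg ω a ∈ Φ₁ := by
      by_contra h
      rcases havg a ha h with h | h
      · exact hua (by rw [h, inner_zero_right])
      · exact hua (horth u hu _ h)
    obtain ⟨b, hb, hvb⟩ := hself v (hunion ▸ Or.inr hv)
    have hb1 : avg ω b ∉ Φ₁ := fun h => hvb (by rw [real_inner_comm]; exact horth _ h v hv)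
    have hAB : ∀ x ∈ D, avg ω x ∈ Φ₁ → ∀ y ∈ D, avg ω y ∉ Φ₁ → ⟪x, y⟫ = 0 := by
      intro x hx hx1 y hy hy1
      refine inner_eq_zero_of_inner_avg_eq_zero hfin
        (fun s t => hinner _ (hpow s hx) _ (hpow t hy) fun h => hy1 ?_) ?_
      · rwa [← avg_pow_apply ω t y, ← h, avg_pow_apply]
      · rcases havg y hy hy1 with h | h
        · rw [h, inner_zero_right]
        · exact horth _ hx1 _ h
    let n : E → ℝ := fun x => if x = -htilde then 1 else coeff htilde x
    have hn : ∀ x ∈ D, 0 < n x := by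
      intro x hx
      by_cases h : x = -htilde
      · simp [n, h]
      · simpa [n, h] using hpos x ((Finset.mem_insert.1 hx).resolve_left h)
    have hrel : ∑ x ∈ D, n x • x = 0 := by
      rw [hD, Finset.sum_insert hmem, Finset.sum_congr rfl (g := fun x => coeff htilde x • x),
        ← hh]
      · simp [n]
      · intro x hx
        have : x ≠ -htilde := fun h => hmem (h ▸ hx)
        simp [n, this]
    let c : E → ℝ := fun x => if avg ω x ∈ Φ₁ then n x else 0
    have hc : ∑ x ∈ D, c x • x = 0 := by
      rw [← inner_self_eq_zero (𝕜 := ℝ)]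
      have hsplit : ∑ x ∈ D, c x • x = -∑ x ∈ D, (n x - c x) • x := by
        simp only [sub_smul, Finset.sum_sub_distrib, hrel, zero_sub, neg_neg]
      conv_lhs => enter [3]; rw [hsplit]
      rw [inner_neg_right, neg_eq_zero, sum_inner]
      refine Finset.sum_eq_zero fun x hx => ?_
      rw [inner_sum]
      refine Finset.sum_eq_zero fun y hy => ?_
      rw [real_inner_smul_left, real_inner_smul_right]
      by_cases hx1 : avg ω x ∈ Φ₁
      · by_cases hy1 : avg ω y ∈ Φ₁
        · simp [c, hy1]
        · rw [hAB x hx hx1 y hy hy1, mul_zero, mul_zero]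
      · simp [c, hx1]
    have h0 := extended_relation_eq_zero hΔ hh hpos hmem hc hb (by simp [c, hb1]) a ha
    simp only [c, ha1, if_true] at h0
    exact (hn a ha).ne' h0
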